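/- arXiv:1109.0207 — 6 statements merged into one kernel-verified Lean document; each statement's English description precedes it below -/
import Mathlib

section
/- Let K be an algebraically closed field of characteristic 0, n ≥ 1, 1 ≤ r ≤ n, d ≥ 2, and let P = [α_0 : ⋯ : α_n] ∈ ℙⁿ(K) have all coordinates nonzero. Let p ∈ P_{r,n} be such that at least one of the ratios α_{p(j)}/α_{p(0)} (1 ≤ j ≤ r) is not a root of unity. If m, m̃ ∈ M_P and there exists λ ∈ K^× such that u_{σ,p}(m) = λ·u_{σ,p}(m̃) for all σ ∈ S_{r+1}, then m = m̃. In other words, the map M_P → ℙ^{(r+1)!−1}(K), m ↦ [u_{σ,p}(m)]_{σ∈S_{r+1}}, is injective. -/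
open scoped BigOperators

noncomputable section

/-- Coordinates (as a vector in `K^{n+1}`) of the point `φ^m(P)` where `φ` is the
`d`-th power map and `P = [α 0 : ⋯ : α n]`. -/
def orbitVec {K : Type*} [Field K] {n : ℕ} (α : Fin (n + 1) → K) (d m : ℕ) :
    Fin (n + 1) → K :=
  fun j => α j ^ d ^ m

/-- The points (given by vectors of homogeneous coordinates) `Q 0, …, Q r` super-span
the projective linear subspace corresponding to the submodule `W`:
all of them lie in `W`, and omitting any one of them the remaining `r` points span `W`. -/
def SuperSpans {K : Type*} [Field K] {n r : ℕ} (W : Submodule K (Fin (n + 1) → K))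
    (Q : Fin (r + 1) → Fin (n + 1) → K) : Prop :=
  (∀ i, Q i ∈ W) ∧
    ∀ i : Fin (r + 1), Submodule.span K {v | ∃ j, j ≠ i ∧ v = Q j} = W

/-- The set `𝓛^r_{φ,P}` of exceptional linear subspaces of projective dimension `r-1`
(i.e. submodules of dimension `r`) that are super-spanned by `r+1` points of the
orbit of `P = [α 0 : ⋯ : α n]` under the `d`-th power map. -/
def exceptionalSubspaces {K : Type*} [Field K] {n : ℕ} (α : Fin (n + 1) → K) (d r : ℕ) :
    Set (Submodule K (Fin (n + 1) → K)) :=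
  {W | Module.finrank K ↥W = r ∧
    ∃ m : Fin (r + 1) → ℕ, SuperSpans W fun i => orbitVec α d (m i)}

/-- The `(r+1) × (n+1)` matrix `A_m` whose `i`-th row is `φ^{m i}(P)`. -/
def Amat {K : Type*} [Field K] {n r : ℕ} (α : Fin (n + 1) → K) (d : ℕ)
    (m : Fin (r + 1) → ℕ) : Matrix (Fin (r + 1)) (Fin (n + 1)) K :=
  Matrix.of fun i j => α j ^ d ^ m i

/-- An `(r+1) × (n+1)` matrix has super-rank `r` if it has rank `r` and every
submatrix formed by deleting one row still has rank `r`. -/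
def HasSuperRank {K : Type*} [Field K] {n r : ℕ}
    (A : Matrix (Fin (r + 1)) (Fin (n + 1)) K) : Prop :=
  A.rank = r ∧ ∀ t : Fin (r + 1), (A.submatrix (Fin.succAbove t) id).rank = r

/-- The set `M_P` of strictly increasing `(r+1)`-tuples `m` such that `A_m` has
super-rank `r`. -/
def MP {K : Type*} [Field K] {n : ℕ} (α : Fin (n + 1) → K) (d r : ℕ) :
    Set (Fin (r + 1) → ℕ) :=
  {m | StrictMono m ∧ HasSuperRank (Amat α d m)}

/-- The linear subspace `L_m` spanned by the rows of `A_m`. -/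
def Lm {K : Type*} [Field K] {n r : ℕ} (α : Fin (n + 1) → K) (d : ℕ)
    (m : Fin (r + 1) → ℕ) : Submodule K (Fin (n + 1) → K) :=
  Submodule.span K (Set.range fun i => Amat α d m i)

/-- `u_{σ,p}(m) = ∏_i α_{p(i)}^{d^{m_{σ(i)}}}`. -/
def uval {K : Type*} [Field K] {n r : ℕ} (α : Fin (n + 1) → K) (d : ℕ)
    (p : Fin (r + 1) → Fin (n + 1)) (σ : Equiv.Perm (Fin (r + 1)))
    (m : Fin (r + 1) → ℕ) : K :=
  ∏ i, α (p i) ^ d ^ m (σ i)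

/-- `F_I(m) = F_I(m̃)`: for every strictly increasing `p` and every block `T` of the
partition `I p`, the tuples `(u_{σ,p}(m))_{σ ∈ T}` and `(u_{σ,p}(m̃))_{σ ∈ T}` agree
up to a nonzero scalar. -/
def FIeq {K : Type*} [Field K] {n r : ℕ} (α : Fin (n + 1) → K) (d : ℕ)
    (I : (Fin (r + 1) → Fin (n + 1)) → Set (Set (Equiv.Perm (Fin (r + 1)))))
    (m m' : Fin (r + 1) → ℕ) : Prop :=
  ∀ p : Fin (r + 1) → Fin (n + 1), StrictMono p → ∀ T ∈ I p,
    ∃ lam : K, lam ≠ 0 ∧ ∀ σ ∈ T, uval α d p σ m = lam * uval α d p σ m'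

/-- A collection of subsets of `S_{r+1}` is an exceptional partition if it is a
subpartition of `I_•^t = {T_0^t, …, T_r^t}` for some `t`, where
`T_j^t = {σ : σ j = t}`. -/
def IsExceptionalPartition {r : ℕ} (c : Set (Set (Equiv.Perm (Fin (r + 1))))) : Prop :=
  ∃ t : Fin (r + 1), ∀ T ∈ c, ∃ j : Fin (r + 1), ∀ σ ∈ T, σ j = t


theorem Nat.pow_exponents_eq_of_add_eq {d x y x' y' : ℕ} (hd : 2 ≤ d) (hxy : x < y)
    (hxy' : x' < y') (h : d ^ y + d ^ x' = d ^ y' + d ^ x) : x = x' ∧ y = y' := by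
  have aux : ∀ {x y x' y' : ℕ}, x < y → x' < y' →
      d ^ y + d ^ x' = d ^ y' + d ^ x → ¬ x < x' := by
    intro x y x' y' hxy hxy' h hlt
    have hdvd : d ^ (x + 1) ∣ d ^ y' + d ^ x :=
      h ▸ dvd_add (pow_dvd_pow d hxy) (pow_dvd_pow d hlt)
    have hdvd' : d ^ (x + 1) ∣ d ^ x :=
      (Nat.dvd_add_right (pow_dvd_pow d (by omega))).mp hdvd
    have hle := (Nat.pow_dvd_pow_iff_le_right hd).mp hdvd'
    omega
  have hx : x = x' :=
    le_antisymm (Nat.not_lt.mp (aux hxy' hxy h.symm)) (Nat.not_lt.mp (aux hxy hxy' h))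
  subst hx
  exact ⟨rfl, Nat.pow_right_injective hd (Nat.add_right_cancel h)⟩

theorem Equiv.Perm.exists_apply_eq_apply_eq {ι : Type*} [DecidableEq ι] {i j a b : ι}
    (hij : i ≠ j) (hab : a ≠ b) : ∃ σ : Equiv.Perm ι, σ i = a ∧ σ j = b := by
  have hne : a ≠ Equiv.swap i a j := by
    intro h
    apply hij
    apply (Equiv.swap i a).injective
    rw [Equiv.swap_apply_left, ← h]
  refine ⟨Equiv.swap (Equiv.swap i a j) b * Equiv.swap i a, ?_, ?_⟩
  · rw [Equiv.Perm.mul_apply, Equiv.swap_apply_left, Equiv.swap_apply_of_ne_of_ne hne hab]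
  · rw [Equiv.Perm.mul_apply, Equiv.swap_apply_left]

theorem uval_mul_uval_swap {K : Type*} [Field K] {n r : ℕ} (α : Fin (n + 1) → K) (d : ℕ)
    (p : Fin (r + 1) → Fin (n + 1)) (σ : Equiv.Perm (Fin (r + 1)))
    (m : Fin (r + 1) → ℕ) {i j : Fin (r + 1)} (hij : i ≠ j) :
    uval α d p σ m * (α (p i) ^ d ^ m (σ j) * α (p j) ^ d ^ m (σ i)) =
      uval α d p (σ * Equiv.swap i j) m *
        (α (p i) ^ d ^ m (σ i) * α (p j) ^ d ^ m (σ j)) := by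
  have hj : j ∈ Finset.univ.erase i := Finset.mem_erase.mpr ⟨hij.symm, Finset.mem_univ j⟩
  have hrest : ∏ k ∈ (Finset.univ.erase i).erase j,
        α (p k) ^ d ^ m ((σ * Equiv.swap i j) k) =
      ∏ k ∈ (Finset.univ.erase i).erase j, α (p k) ^ d ^ m (σ k) := by
    refine Finset.prod_congr rfl fun k hk => ?_
    simp only [Finset.mem_erase] at hk
    rw [Equiv.Perm.mul_apply, Equiv.swap_apply_of_ne_of_ne hk.2.1 hk.1]
  simp only [uval]
  rw [← Finset.mul_prod_erase _ _ (Finset.mem_univ i), ← Finset.mul_prod_erase _ _ hj,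
    ← Finset.mul_prod_erase _ (fun k => α (p k) ^ d ^ m ((σ * Equiv.swap i j) k))
      (Finset.mem_univ i), ← Finset.mul_prod_erase _ _ hj, hrest]
  simp only [Equiv.Perm.mul_apply, Equiv.swap_apply_left, Equiv.swap_apply_right]
  ring

theorem uval_ne_zero {K : Type*} [Field K] {n r : ℕ} {α : Fin (n + 1) → K}
    (hα : ∀ i, α i ≠ 0) (d : ℕ) (p : Fin (r + 1) → Fin (n + 1))
    (σ : Equiv.Perm (Fin (r + 1))) (m : Fin (r + 1) → ℕ) : uval α d p σ m ≠ 0 :=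
  Finset.prod_ne_zero_iff.mpr fun _ _ => pow_ne_zero _ (hα _)

/-- injectivity of `m ↦ [u_{σ,p}(m)]_{σ ∈ S_{r+1}}` on `M_P`, provided some
ratio `α_{p(j)}/α_{p(0)}`, `1 ≤ j ≤ r`, is not a root of unity. -/
theorem stmt5 {K : Type*} [Field K] [IsAlgClosed K] [CharZero K]
    (n r d : ℕ) (hn : 1 ≤ n) (hr1 : 1 ≤ r) (hrn : r ≤ n) (hd : 2 ≤ d)
    (α : Fin (n + 1) → K) (hα : ∀ i, α i ≠ 0)
    (p : Fin (r + 1) → Fin (n + 1)) (hp : StrictMono p)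
    (hroot : ∃ j : Fin (r + 1), j ≠ 0 ∧
      ¬∃ k : ℕ, 0 < k ∧ (α (p j) / α (p 0)) ^ k = 1)
    (m m' : Fin (r + 1) → ℕ) (hm : m ∈ MP α d r) (hm' : m' ∈ MP α d r)
    (h : ∃ lam : K, lam ≠ 0 ∧
      ∀ σ : Equiv.Perm (Fin (r + 1)), uval α d p σ m = lam * uval α d p σ m') :
    m = m' := by
  obtain ⟨j, hj, hβ⟩ := hroot
  obtain ⟨lam, hlam, hu⟩ := h
  have hinj : Function.Injective fun k : ℕ => (α (p j) / α (p 0)) ^ k := by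
    have hβ0 : α (p j) / α (p 0) ≠ 0 := div_ne_zero (hα _) (hα _)
    refine Function.Injective.of_lt_imp_ne fun k l hkl hpow => hβ ⟨l - k, Nat.sub_pos_of_lt hkl, ?_⟩
    apply mul_left_cancel₀ (pow_ne_zero k hβ0)
    rw [← pow_add, Nat.add_sub_cancel' hkl.le, mul_one]
    exact hpow.symm
  have key : ∀ a b : Fin (r + 1), a < b → m a = m' a ∧ m b = m' b := by
    intro a b hab
    obtain ⟨σ, rfl, rfl⟩ := Equiv.Perm.exists_apply_eq_apply_eq hj.symm hab.ne
    refine Nat.pow_exponents_eq_of_add_eq hd (hm.1 hab) (hm'.1 hab) (hinj ?_)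
    have e := uval_mul_uval_swap α d p σ m hj.symm
    have e' := uval_mul_uval_swap α d p σ m' hj.symm
    rw [hu, hu] at e
    have hv := uval_ne_zero hα d p σ m'
    have hw := uval_ne_zero hα d p (σ * Equiv.swap 0 j) m'
    have hx := hα (p 0)
    generalize uval α d p σ m' = v at *
    generalize uval α d p (σ * Equiv.swap 0 j) m' = w at *
    simp only [div_pow]
    rw [div_eq_div_iff (pow_ne_zero _ hx) (pow_ne_zero _ hx)]
    simp only [pow_add]
    apply mul_left_cancel₀ (mul_ne_zero hlam (mul_ne_zero hv hw))
    linear_combination lam * w * (α (p 0) ^ d ^ m (σ 0) * α (p j) ^ d ^ m (σ j)) * e' -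
      w * (α (p 0) ^ d ^ m' (σ 0) * α (p j) ^ d ^ m' (σ j)) * e
  have hlast : (0 : Fin (r + 1)) < Fin.last r := Fin.lt_def.mpr (by simpa using Nat.pos_of_ne_zero (by omega))
  funext i
  rcases eq_or_ne i 0 with rfl | hi
  · exact (key _ _ hlast).1
  · exact (key _ _ (Fin.pos_iff_ne_zero.mpr hi)).2

end
end

section
/- Let K be an algebraically closed field of characteristic 0, n ≥ 1, 1 ≤ r ≤ n, d ≥ 2, and let P = [α_0 : ⋯ : α_n] ∈ ℙⁿ(K) have all coordinates nonzero with multiplicative relation set R(P) = {0}. For each p ∈ P_{r,n} fix a partition I_p of S_{r+1}. Suppose m, m̃ ∈ M_P satisfy F_I(m) = F_I(m̃) and m_t ≠ m̃_t for some index t ∈ {0,…,r}. Then for every p ∈ P_{r,n}, every block T ∈ I_p, and all σ, τ ∈ T, one has σ^{-1}(t) = τ^{-1}(t); that is, every I_p is a subpartition of I_•^t. In particular, if some I_p is not exceptional, then F_I(m) = F_I(m̃) implies m = m̃ for all m, m̃ ∈ M_P. -/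
open scoped BigOperators

noncomputable section

/-- In a fixed base `d ≥ 2`, a sum of two powers of `d` determines its unordered pair of
exponents. -/
theorem eq_or_eq_of_pow_add_pow_eq {d a b c e : ℕ} (hd : 2 ≤ d)
    (h : d ^ a + d ^ b = d ^ c + d ^ e) : a = c ∨ a = e := by
  have pow_double_le : ∀ {x y : ℕ}, x < y → 2 * d ^ x ≤ d ^ y := fun {x y} hxy =>
    calc 2 * d ^ x ≤ d * d ^ x := Nat.mul_le_mul_right _ hd
      _ = d ^ (x + 1) := by ring
      _ ≤ d ^ y := Nat.pow_le_pow_right (by lia) hxy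
  have pow_pos : ∀ x : ℕ, 0 < d ^ x := fun x => Nat.pow_pos (by lia)
  by_contra! hne
  obtain ⟨hac, hae⟩ := hne
  have hbc : b ≠ c := fun hbc => hae (Nat.pow_right_injective hd (by subst hbc; simp only; lia))
  have hbe : b ≠ e := fun hbe => hac (Nat.pow_right_injective hd (by subst hbe; simp only; lia))
  have ha := pow_pos a
  have hb := pow_pos b
  have hc := pow_pos c
  have he := pow_pos e
  rcases lt_or_gt_of_ne hac with h1 | h1 <;> rcases lt_or_gt_of_ne hae with h2 | h2 <;>
    rcases lt_or_gt_of_ne hbc with h3 | h3 <;> rcases lt_or_gt_of_ne hbe with h4 | h4 <;>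
    have h1 := pow_double_le h1 <;> have h2 := pow_double_le h2 <;>
    have h3 := pow_double_le h3 <;> have h4 := pow_double_le h4 <;> lia

/-- If `α` has no nontrivial homogeneous multiplicative relations, neither has any family of
distinct coordinates of `α`. -/
theorem eq_zero_of_prod_zpow_comp_eq_one {ι κ K : Type*} [Fintype ι] [Fintype κ] [Field K]
    {α : κ → K} (hrel : ∀ e : κ → ℤ, (∑ i, e i) = 0 → (∏ i, α i ^ e i) = 1 → e = 0)
    {p : ι → κ} (hp : Function.Injective p) {c : ι → ℤ} (hsum : ∑ i, c i = 0)
    (hprod : ∏ i, α (p i) ^ c i = 1) : c = 0 := by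
  have hout : ∀ k ∉ Set.range p, Function.extend p c 0 k = 0 := fun k hk =>
    Function.extend_apply' _ _ _ hk
  have hzero : Function.extend p c 0 = 0 := by
    refine hrel _ ?_ ?_
    · rw [← hsum]
      exact (Fintype.sum_of_injective p hp _ _ hout fun i => (hp.extend_apply _ _ _).symm).symm
    · rw [← hprod]
      exact (Fintype.prod_of_injective p hp _ _ (fun k hk => by rw [hout k hk, zpow_zero])
        fun i => by rw [hp.extend_apply]).symm
  ext i
  rw [← hp.extend_apply c 0 i, hzero]
  rfl

/-- If the ratio of `u_{σ,p}` and `u_{τ,p}` agrees at `m` and `m'`, then so do the coordinatewise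
differences of exponents. -/
theorem pow_add_pow_eq_of_uval_eq {K : Type*} [Field K] {n r d : ℕ}
    {α : Fin (n + 1) → K} (hα : ∀ i, α i ≠ 0)
    (hrel : ∀ e : Fin (n + 1) → ℤ, (∑ i, e i) = 0 → (∏ i, α i ^ e i) = 1 → e = 0)
    {p : Fin (r + 1) → Fin (n + 1)} (hp : Function.Injective p)
    {σ τ : Equiv.Perm (Fin (r + 1))} {m m' : Fin (r + 1) → ℕ} {lam : K}
    (hσ : uval α d p σ m = lam * uval α d p σ m')
    (hτ : uval α d p τ m = lam * uval α d p τ m') (i : Fin (r + 1)) :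
    d ^ m (σ i) + d ^ m' (τ i) = d ^ m (τ i) + d ^ m' (σ i) := by
  have hne : ∀ (ρ : Equiv.Perm (Fin (r + 1))) (k : Fin (r + 1) → ℕ), uval α d p ρ k ≠ 0 :=
    fun ρ k => Finset.prod_ne_zero_iff.mpr fun i _ => pow_ne_zero _ (hα _)
  have hzero := eq_zero_of_prod_zpow_comp_eq_one hrel hp
    (c := fun i => ((d ^ m (σ i) : ℕ) : ℤ) + (d ^ m' (τ i) : ℕ)
      - ((d ^ m (τ i) : ℕ) + (d ^ m' (σ i) : ℕ)))
    (by
      simp only [Finset.sum_sub_distrib, Finset.sum_add_distrib]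
      rw [Equiv.sum_comp σ fun j => ((d ^ m j : ℕ) : ℤ),
        Equiv.sum_comp τ fun j => ((d ^ m j : ℕ) : ℤ),
        Equiv.sum_comp σ fun j => ((d ^ m' j : ℕ) : ℤ),
        Equiv.sum_comp τ fun j => ((d ^ m' j : ℕ) : ℤ), sub_self])
    (by
      have hsplit : ∀ i, α (p i) ^ (((d ^ m (σ i) : ℕ) : ℤ) + (d ^ m' (τ i) : ℕ)
          - ((d ^ m (τ i) : ℕ) + (d ^ m' (σ i) : ℕ))) =
          α (p i) ^ d ^ m (σ i) * α (p i) ^ d ^ m' (τ i)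
            / (α (p i) ^ d ^ m (τ i) * α (p i) ^ d ^ m' (σ i)) := fun i => by
        rw [zpow_sub₀ (hα _), zpow_add₀ (hα _), zpow_add₀ (hα _)]
        simp only [zpow_natCast]
      simp only [hsplit, Finset.prod_div_distrib, Finset.prod_mul_distrib]
      change uval α d p σ m * uval α d p τ m' / (uval α d p τ m * uval α d p σ m') = 1
      rw [div_eq_one_iff_eq (mul_ne_zero (hne _ _) (hne _ _)), hσ, hτ]
      ring)
  have hi := congrFun hzero i
  simp only [Pi.zero_apply] at hi
  lia

/-- if `R(P) = {0}`, `m, m̃ ∈ M_P` satisfy `F_I(m) = F_I(m̃)` and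
`m_t ≠ m̃_t`, then every `I_p` is a subpartition of `I_•^t`; in particular, if some
`I_p` is not exceptional then `F_I` is injective on `M_P`. -/
theorem stmt7 {K : Type*} [Field K] [IsAlgClosed K] [CharZero K]
    (n r d : ℕ) (hn : 1 ≤ n) (hr1 : 1 ≤ r) (hrn : r ≤ n) (hd : 2 ≤ d)
    (α : Fin (n + 1) → K) (hα : ∀ i, α i ≠ 0)
    (hrel : ∀ e : Fin (n + 1) → ℤ, (∑ i, e i) = 0 → (∏ i, α i ^ e i) = 1 → e = 0)
    (I : (Fin (r + 1) → Fin (n + 1)) → Set (Set (Equiv.Perm (Fin (r + 1)))))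
    (hI : ∀ p : Fin (r + 1) → Fin (n + 1), StrictMono p → Setoid.IsPartition (I p)) :
    (∀ m m' : Fin (r + 1) → ℕ, m ∈ MP α d r → m' ∈ MP α d r → FIeq α d I m m' →
      ∀ t : Fin (r + 1), m t ≠ m' t →
        ∀ p : Fin (r + 1) → Fin (n + 1), StrictMono p →
          ∀ T ∈ I p, ∀ σ ∈ T, ∀ τ ∈ T, σ⁻¹ t = τ⁻¹ t) ∧
    ((∃ p : Fin (r + 1) → Fin (n + 1), StrictMono p ∧ ¬IsExceptionalPartition (I p)) →
      ∀ m m' : Fin (r + 1) → ℕ, m ∈ MP α d r → m' ∈ MP α d r →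
        FIeq α d I m m' → m = m') := by
  have main : ∀ m m' : Fin (r + 1) → ℕ, m ∈ MP α d r → m' ∈ MP α d r → FIeq α d I m m' →
      ∀ t : Fin (r + 1), m t ≠ m' t →
        ∀ p : Fin (r + 1) → Fin (n + 1), StrictMono p →
          ∀ T ∈ I p, ∀ σ ∈ T, ∀ τ ∈ T, σ⁻¹ t = τ⁻¹ t := by
    intro m m' hm _ hF t ht p hp T hT σ hσ τ hτ
    obtain ⟨lam, -, hlam⟩ := hF p hp T hT
    have key := pow_add_pow_eq_of_uval_eq hα hrel hp.injective (hlam σ hσ) (hlam τ hτ) (σ⁻¹ t)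
    simp only [Equiv.Perm.inv_def, Equiv.apply_symm_apply] at key
    rcases eq_or_eq_of_pow_add_pow_eq hd key with h | h
    · rw [Equiv.Perm.eq_inv_iff_eq]
      exact (hm.1.injective h).symm
    · exact absurd h ht
  refine ⟨main, ?_⟩
  rintro ⟨p, hp, hexc⟩ m m' hm hm' hF
  by_contra hne
  obtain ⟨t, ht⟩ := Function.ne_iff.mp hne
  refine hexc ⟨t, fun T hT => ?_⟩
  obtain ⟨σ, hσ⟩ := Setoid.nonempty_of_mem_partition (hI p hp) hT
  refine ⟨σ⁻¹ t, fun τ hτ => ?_⟩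
  rw [main m m' hm hm' hF t ht p hp T hT σ hσ τ hτ, Equiv.Perm.inv_def, Equiv.apply_symm_apply]

end
end

section
/- Let K be an algebraically closed field of characteristic 0, n ≥ 1, 1 ≤ r ≤ n, d ≥ 2, and let P = [α_0 : ⋯ : α_n] ∈ ℙⁿ(K) have all coordinates nonzero. For each p ∈ P_{r,n} let I_p be a partition of S_{r+1}, and suppose there is an index t ∈ {0,…,r} such that every I_p is a subpartition of I_•^t. Let m = (m_0, …, m_r) be a tuple of integers with 0 ≤ m_0 < m_1 < ⋯ < m_r such that Σ_{σ∈T} sgn(σ)·u_{σ,p}(m) = 0 for every p ∈ P_{r,n} and every block T ∈ I_p. Then the r×(n+1) matrix obtained by deleting the t-th row of A_m has rank at most r−1; in particular A_m does not have super-rank r, so m ∉ M_P. -/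
open scoped BigOperators

noncomputable section

/-- If the sums of `f` over the blocks of a partition vanish, then so does the sum of `f` over
any finite set that contains every block it meets. -/
theorem sum_eq_zero_of_isPartition {ι M : Type*} [Finite ι] [AddCommMonoid M]
    {c : Set (Set ι)} (hc : Setoid.IsPartition c) {f : ι → M}
    (hf : ∀ T ∈ c, ∑ x ∈ (Set.toFinite T).toFinset, f x = 0)
    (F : Finset ι) (hF : ∀ T ∈ c, ∀ x ∈ T, x ∈ F → T ⊆ F) :
    ∑ x ∈ F, f x = 0 := by
  classical
  choose b hb hb' using fun x => hc.2 x
  rw [← Finset.sum_fiberwise_of_maps_to (fun x hx => Finset.mem_image_of_mem b hx)]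
  refine Finset.sum_eq_zero fun T hT => ?_
  obtain ⟨x, hx, rfl⟩ := Finset.mem_image.1 hT
  rw [← hf (b x) (hb x).1]
  refine Finset.sum_congr (Finset.ext fun y => ?_) fun _ _ => rfl
  simp only [Finset.mem_filter, Set.Finite.mem_toFinset]
  constructor
  · rintro ⟨-, h⟩
    exact h ▸ (hb y).2
  · intro hy
    exact ⟨hF _ (hb x).1 x (hb x).2 hx hy, (hb' y _ ⟨(hb x).1, hy⟩).symm⟩

/-- The part of the Leibniz expansion of `det A` given by the permutations with `σ j = t` is
the corresponding term of the Laplace expansion. -/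
theorem sum_sign_mul_prod_of_apply_eq {R : Type*} [CommRing R] {r : ℕ}
    (A : Matrix (Fin (r + 1)) (Fin (r + 1)) R) (j t : Fin (r + 1)) :
    ∑ σ : Equiv.Perm (Fin (r + 1)) with σ j = t,
        ((Equiv.Perm.sign σ : ℤ) : R) * ∏ i, A (σ i) i =
      A t j * ((-1) ^ (t + j : ℕ) * (A.submatrix t.succAbove j.succAbove).det) := by
  rw [← Matrix.adjugate_fin_succ_eq_det_submatrix, Matrix.adjugate_apply,
    ← Matrix.det_updateRow_smul, Matrix.det_apply', Finset.sum_filter]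
  refine Finset.sum_congr rfl fun σ _ => ?_
  split_ifs with h
  · congr 1
    refine Finset.prod_congr rfl fun i _ => ?_
    by_cases hi : i = j
    · subst hi
      simp [h]
    · have hσ : σ i ≠ t := fun h' => hi (σ.injective (h'.trans h.symm))
      simp [Matrix.updateRow_ne hσ]
  · have hj : σ.symm t ≠ j := fun h' => h (by simp [← h'])
    rw [Finset.prod_eq_zero (Finset.mem_univ (σ.symm t)) (by simp [hj]), mul_zero]

/-- A matrix with `r` rows, at least `r + 1` columns and rank at least `r` has a nonzero maximal
minor, obtained by omitting one of `r + 1` increasingly ordered columns. -/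
theorem exists_strictMono_det_submatrix_ne_zero {K : Type*} [Field K] {n r : ℕ} (hrn : r ≤ n)
    (B : Matrix (Fin r) (Fin (n + 1)) K) (hB : r ≤ B.rank) :
    ∃ p : Fin (r + 1) → Fin (n + 1), StrictMono p ∧
      ∃ j : Fin (r + 1), (B.submatrix id (p ∘ j.succAbove)).det ≠ 0 := by
  classical
  obtain ⟨κ, a, ha, hspan, hli⟩ := exists_linearIndependent' K B.col
  have : Fintype κ := Fintype.ofInjective a ha
  have hκ : Fintype.card κ = r := by
    refine le_antisymm (by simpa using hli.fintype_card_le_finrank) ?_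
    rwa [← finrank_span_eq_card hli, hspan, ← Matrix.rank_eq_finrank_span_cols]
  have hcard : (Finset.univ.map ⟨a, ha⟩).card = r := by simp [hκ]
  obtain ⟨k, -, hk⟩ : ∃ k ∈ Finset.univ, k ∉ Finset.univ.map ⟨a, ha⟩ :=
    Finset.exists_mem_notMem_of_card_lt_card (by simp [hκ]; omega)
  have hs : (insert k (Finset.univ.map ⟨a, ha⟩)).card = r + 1 := by
    rw [Finset.card_insert_of_notMem hk, hcard]
  set p := (insert k (Finset.univ.map ⟨a, ha⟩)).orderEmbOfFin hs with hp
  obtain ⟨j, hj⟩ : k ∈ Set.range p := by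
    rw [hp, Finset.range_orderEmbOfFin]
    simp
  refine ⟨p, p.strictMono, j, ?_⟩
  have hmem : ∀ i, ∃ x, a x = p (j.succAbove i) := fun i => by
    have h := Finset.orderEmbOfFin_mem _ hs (j.succAbove i)
    rw [← hp] at h
    rcases Finset.mem_insert.1 h with h | h
    · exact absurd (p.injective (h.trans hj.symm)) (Fin.succAbove_ne j i)
    · simpa using h
  choose e he using hmem
  have hinj : Function.Injective e := fun x y hxy =>
    Fin.succAbove_right_injective (p.injective (by rw [← he, ← he, hxy]))
  have hcols : LinearIndependent K (B.submatrix id (p ∘ j.succAbove)).col := by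
    have hcol : (B.submatrix id (p ∘ j.succAbove)).col = (B.col ∘ a) ∘ e := by
      ext i x
      simp [he, Matrix.col_apply]
    exact hcol ▸ hli.comp e hinj
  rw [Matrix.linearIndependent_cols_iff_isUnit, Matrix.isUnit_iff_isUnit_det] at hcols
  exact hcols.ne_zero

/-- if every `I_p` is a subpartition of `I_•^t` and all the subsums of the
determinant expansions corresponding to the blocks of the `I_p` vanish at `m`, then
deleting the `t`-th row of `A_m` leaves a matrix of rank at most `r - 1`; in particular
`A_m` does not have super-rank `r` and `m ∉ M_P`. -/
theorem stmt8 {K : Type*} [Field K] [IsAlgClosed K] [CharZero K]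
    (n r d : ℕ) (hn : 1 ≤ n) (hr1 : 1 ≤ r) (hrn : r ≤ n) (hd : 2 ≤ d)
    (α : Fin (n + 1) → K) (hα : ∀ i, α i ≠ 0)
    (I : (Fin (r + 1) → Fin (n + 1)) → Set (Set (Equiv.Perm (Fin (r + 1)))))
    (hI : ∀ p : Fin (r + 1) → Fin (n + 1), StrictMono p → Setoid.IsPartition (I p))
    (t : Fin (r + 1))
    (hsub : ∀ p : Fin (r + 1) → Fin (n + 1), StrictMono p →
      ∀ T ∈ I p, ∃ j : Fin (r + 1), ∀ σ ∈ T, σ j = t)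
    (m : Fin (r + 1) → ℕ) (hmono : StrictMono m)
    (hvanish : ∀ p : Fin (r + 1) → Fin (n + 1), StrictMono p → ∀ T ∈ I p,
      ∑ σ ∈ (Set.toFinite T).toFinset,
        ((Equiv.Perm.sign σ : ℤ) : K) * uval α d p σ m = 0) :
    ((Amat α d m).submatrix (Fin.succAbove t) id).rank ≤ r - 1 ∧
      ¬HasSuperRank (Amat α d m) ∧ m ∉ MP α d r := by
  have hrank : ((Amat α d m).submatrix (Fin.succAbove t) id).rank ≤ r - 1 := by
    by_contra hlt
    obtain ⟨p, hp, j, hdet⟩ := exists_strictMono_det_submatrix_ne_zero hrn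
      ((Amat α d m).submatrix (Fin.succAbove t) id) (by omega)
    have hsum : ∑ σ : Equiv.Perm (Fin (r + 1)) with σ j = t,
        ((Equiv.Perm.sign σ : ℤ) : K) * uval α d p σ m = 0 := by
      refine sum_eq_zero_of_isPartition (hI p hp) (hvanish p hp) _ fun T hT σ hσ hσj τ hτ => ?_
      obtain ⟨j', hj'⟩ := hsub p hp T hT
      obtain rfl : j' = j := σ.injective ((hj' σ hσ).trans ((Finset.mem_filter.1 hσj).2.symm))
      simpa using hj' τ hτ
    have hexp := sum_sign_mul_prod_of_apply_eq ((Amat α d m).submatrix id p) j t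
    refine mul_ne_zero (pow_ne_zero (d ^ m t) (hα (p j)))
      (mul_ne_zero (pow_ne_zero (t + j : ℕ) (neg_ne_zero.2 one_ne_zero)) hdet) ?_
    exact hexp.symm.trans hsum
  have hsuper : ¬HasSuperRank (Amat α d m) := fun h => by
    have := h.2 t
    omega
  exact ⟨hrank, hsuper, fun h => hsuper h.2⟩

end
end

section
/- Let n ≥ 2 and d ≥ 2 be integers, let K be an algebraically closed field of characteristic 0, and let φ_d be the d-th power map on ℙⁿ(K). Let ℓ ≥ 3 be a prime such that d is a primitive root modulo ℓ (i.e., d mod ℓ generates (ℤ/ℓℤ)^×), let ζ ∈ K be a primitive ℓ-th root of unity, let α_2, …, α_n ∈ K^× be multiplicatively independent, and set P = [1 : ζ : α_2 : ⋯ : α_n]. Then for every integer 0 < i < ℓ, the hyperplane H_i = {[x_0 : ⋯ : x_n] ∈ ℙⁿ : x_1 = ζ^i x_0} is an exceptional hyperplane for φ_d and P, i.e., H_i ∈ 𝓛^n_{φ_d,P}. -/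
open scoped BigOperators

noncomputable section

open Filter Topology

/-- Balls of radius less than one around `1` are stable under taking powers. -/
lemma norm_pow_sub_one_le {L : Type*} [NormedField L] [IsUltrametricDist L] {x : L}
    (hx : ‖x‖ ≤ 1) (k : ℕ) : ‖x ^ k - 1‖ ≤ ‖x - 1‖ := by
  rw [← geom_sum_mul, norm_mul]
  refine mul_le_of_le_one_left (norm_nonneg _) ?_
  refine IsUltrametricDist.norm_sum_le_of_forall_le_of_nonneg zero_le_one fun i _ => ?_
  rw [norm_pow]
  exact pow_le_one₀ (norm_nonneg _) hx

lemma tendsto_pow_prime_pow {L : Type*} [NormedField L] [IsUltrametricDist L] {p : ℕ}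
    (hp : ‖(p : L)‖ < 1) {x : L} (hx : ‖x‖ ≤ 1) (hx1 : ‖x - 1‖ < 1) :
    Tendsto (fun s : ℕ => x ^ p ^ s) atTop (𝓝 1) := by
  set r := max ‖(p : L)‖ ‖x - 1‖ with hr
  have hr0 : 0 ≤ r := le_max_of_le_left (norm_nonneg _)
  have hr1 : r < 1 := max_lt hp hx1
  have key : ∀ s : ℕ, ‖x ^ p ^ s - 1‖ ≤ r ^ s * ‖x - 1‖ := by
    intro s
    induction s with
    | zero => simp
    | succ s ih =>
      set y := x ^ p ^ s with hy
      have hy1 : ‖y‖ ≤ 1 := by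
        rw [hy, norm_pow]; exact pow_le_one₀ (norm_nonneg _) hx
      have hsum : ‖∑ i ∈ Finset.range p, y ^ i‖ ≤ r := by
        have : ∑ i ∈ Finset.range p, y ^ i = (∑ i ∈ Finset.range p, (y ^ i - 1)) + (p : L) := by
          simp
        rw [this]
        refine (IsUltrametricDist.norm_add_le_max _ _).trans (max_le ?_ (le_max_left _ _))
        refine IsUltrametricDist.norm_sum_le_of_forall_le_of_nonneg hr0 fun i _ => ?_
        exact (norm_pow_sub_one_le hy1 i).trans
          ((norm_pow_sub_one_le hx _).trans (le_max_right _ _))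
      calc ‖x ^ p ^ (s + 1) - 1‖ = ‖∑ i ∈ Finset.range p, y ^ i‖ * ‖y - 1‖ := by
            rw [← norm_mul, geom_sum_mul, hy, ← pow_mul, ← pow_succ]
        _ ≤ r * (r ^ s * ‖x - 1‖) := by gcongr
        _ = r ^ (s + 1) * ‖x - 1‖ := by ring
  rw [tendsto_iff_norm_sub_tendsto_zero]
  refine squeeze_zero (fun _ => norm_nonneg _) key ?_
  simpa using (tendsto_pow_atTop_nhds_zero_of_lt_one hr0 hr1).mul_const ‖x - 1‖

lemma exists_dvd_pow_mul_coprime (e : ℕ) {M : ℕ} (hM : 0 < M) :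
    ∃ T B : ℕ, 0 < B ∧ B.Coprime e ∧ M ∣ e ^ T * B := by
  induction M using Nat.strong_induction_on with
  | _ M ih =>
    by_cases h : M.Coprime e
    · exact ⟨0, M, hM, h, by simp⟩
    · set g := M.gcd e with hg
      have hg0 : 0 < g := Nat.gcd_pos_of_pos_left _ hM
      have hg1 : 1 < g := lt_of_le_of_ne hg0 (Ne.symm h)
      obtain ⟨M', hM'⟩ := Nat.gcd_dvd_left M e
      rw [← hg] at hM'
      have hM'0 : 0 < M' := Nat.pos_of_ne_zero fun h0 => by simp [h0] at hM'; omega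
      obtain ⟨T, B, hB, hBe, hd⟩ := ih M' (by nlinarith) hM'0
      refine ⟨T + 1, B, hB, hBe, ?_⟩
      rw [hM', pow_succ, mul_comm _ e, mul_assoc]
      exact mul_dvd_mul (Nat.gcd_dvd_right M e) hd

/-- A common power of finitely many units is close to `1`. -/
lemma exists_pow_sub_one_lt {κ L : Type*} [Fintype κ] [NormedField L] [ProperSpace L]
    (δ : κ → L) (hδ : ∀ a, ‖δ a‖ = 1) {ε : ℝ} (hε : 0 < ε) :
    ∃ M : ℕ, 0 < M ∧ ∀ a, ‖δ a ^ M - 1‖ < ε := by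
  have hmem : ∀ m : ℕ, δ ^ m ∈ Metric.closedBall (0 : κ → L) 1 := fun m => by
    rw [mem_closedBall_zero_iff, pi_norm_le_iff_of_nonneg zero_le_one]
    simp [hδ]
  obtain ⟨y, -, φ, hφ, hlim⟩ := (isCompact_closedBall (0 : κ → L) 1).tendsto_subseq hmem
  obtain ⟨N, hN⟩ := Metric.cauchySeq_iff.mp hlim.cauchySeq ε hε
  refine ⟨φ (N + 1) - φ N, Nat.sub_pos_of_lt (hφ (Nat.lt_succ_self N)), fun a => ?_⟩
  have h1 := hN (N + 1) (Nat.le_succ N) N le_rfl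
  rw [dist_eq_norm, pi_norm_lt_iff hε] at h1
  have h2 := h1 a
  have h3 : δ a ^ φ (N + 1) - δ a ^ φ N = δ a ^ φ N * (δ a ^ (φ (N + 1) - φ N) - 1) := by
    rw [mul_sub, ← pow_add, Nat.add_sub_cancel' (hφ (Nat.lt_succ_self N)).le, mul_one]
  simpa [h3, hδ] using h2

/-- Finitely many units of a proper ultrametric field of residue characteristic `p` return
arbitrarily close to themselves under the iterates of the power map of exponent `e` prime to `p`. -/
lemma exists_powerMap_recurrence {κ L : Type*} [Fintype κ] [NormedField L] [ProperSpace L]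
    [IsUltrametricDist L] {p e : ℕ} (hpp : p.Prime) (hp : ‖(p : L)‖ < 1) (hpe : p.Coprime e)
    (he : 0 < e) (δ : κ → L) (hδ : ∀ a, ‖δ a‖ = 1) :
    ∃ (T : ℕ) (u : ℕ → ℕ), (∀ s, s < u s) ∧ ∀ t ≥ T, ∀ a,
      Tendsto (fun s => δ a ^ (e ^ t * (e ^ u s - 1))) atTop (𝓝 1) := by
  obtain ⟨M, hM, hM1⟩ := exists_pow_sub_one_lt δ hδ one_pos
  obtain ⟨T, B, hB, hBe, hMd⟩ := exists_dvd_pow_mul_coprime e hM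
  refine ⟨T, fun s => (B * p ^ s).totient * (s + 1), fun s => ?_, fun t ht a => ?_⟩
  · have : 0 < (B * p ^ s).totient := Nat.totient_pos.mpr (Nat.mul_pos hB (pow_pos hpp.pos s))
    nlinarith
  have hdvd : ∀ s, M * p ^ s ∣ e ^ t * (e ^ ((B * p ^ s).totient * (s + 1)) - 1) := by
    intro s
    have h1 : B * p ^ s ∣ e ^ ((B * p ^ s).totient * (s + 1)) - 1 := by
      have hc : e.Coprime (B * p ^ s) := (hBe.mul_left (hpe.pow_left s)).symm
      have := (Nat.ModEq.pow_totient hc).pow (s + 1)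
      rw [one_pow, ← pow_mul] at this
      exact (Nat.modEq_iff_dvd' (Nat.one_le_pow _ _ he)).mp this.symm
    calc M * p ^ s ∣ e ^ T * B * p ^ s := mul_dvd_mul_right hMd _
      _ = e ^ T * (B * p ^ s) := mul_assoc _ _ _
      _ ∣ _ := mul_dvd_mul (pow_dvd_pow e ht) h1
  have hlim := tendsto_pow_prime_pow hp (x := δ a ^ M) (by simp [hδ]) (hM1 a)
  rw [tendsto_iff_norm_sub_tendsto_zero] at hlim ⊢
  refine squeeze_zero (fun _ => norm_nonneg _) (fun s => ?_) hlim
  obtain ⟨k, hk⟩ := hdvd s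
  rw [hk, pow_mul, pow_mul]
  exact norm_pow_sub_one_le (by simp [hδ]) k

lemma exists_coeff_multiplier {κ L : Type*} [Fintype κ] [NormedField L] [ProperSpace L]
    [IsUltrametricDist L] [CharZero L] {p e : ℕ} (hpp : p.Prime) (hp : ‖(p : L)‖ < 1)
    (hpe : p.Coprime e) (he : 2 ≤ e) (δ : κ → L) (hδ : ∀ a, ‖δ a‖ = 1)
    (hnt : ∃ b, ∀ k > 0, δ b ^ k ≠ 1) :
    ∃ μ : κ → L, (∃ a, μ a ≠ 0) ∧ (∀ a, δ a = 1 → μ a = 0) ∧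
      ∀ c : κ → L, (∀ᶠ t : ℕ in atTop, ∑ a, c a * δ a ^ e ^ t = 0) →
        ∀ᶠ t : ℕ in atTop, ∑ a, c a * μ a * δ a ^ e ^ t = 0 := by
  obtain ⟨T, u, hu, hlim⟩ := exists_powerMap_recurrence hpp hp hpe (by omega) δ hδ
  obtain ⟨b, hb⟩ := hnt
  have : Nonempty κ := ⟨b⟩
  set y : ℕ → κ → L := fun s a => δ a ^ (e ^ T * (e ^ u s - 1)) - 1 with hy
  have hy0 : ∀ s, y s b ≠ 0 := fun s => by
    refine sub_ne_zero.mpr (hb _ (Nat.mul_pos (by positivity) (Nat.sub_pos_of_lt ?_)))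
    exact Nat.one_lt_pow (by have := hu s; omega) (by omega)
  have hmax : ∀ s, ∃ a, ∀ a', ‖y s a'‖ ≤ ‖y s a‖ := fun s => Finite.exists_max fun a => ‖y s a‖
  choose m hm using hmax
  have hm0 : ∀ s, y s (m s) ≠ 0 := fun s =>
    norm_pos_iff.mp ((norm_pos_iff.mpr (hy0 s)).trans_le (hm s b))
  set z : ℕ → κ → L := fun s a => (y s (m s))⁻¹ * y s a with hz
  have hzmem : ∀ s, z s ∈ Metric.sphere (0 : κ → L) 1 := fun s => by
    rw [mem_sphere_zero_iff_norm]
    refine le_antisymm ((pi_norm_le_iff_of_nonneg zero_le_one).mpr fun a => ?_) ?_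
    · rw [hz, norm_mul, norm_inv]
      exact inv_mul_le_one_of_le₀ (hm s a) (norm_nonneg _)
    · refine le_of_eq_of_le ?_ (norm_le_pi_norm (z s) (m s))
      simp [hz, hm0 s]
  obtain ⟨μ, hμ, ψ, hψ, hzlim⟩ := (isCompact_sphere (0 : κ → L) 1).tendsto_subseq hzmem
  have hzlim' : ∀ a, Tendsto (fun s => z (ψ s) a) atTop (𝓝 (μ a)) := tendsto_pi_nhds.mp hzlim
  refine ⟨μ, ?_, fun a ha => ?_, fun c hc => ?_⟩
  · by_contra! h
    have : μ = 0 := funext h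
    simp [this] at hμ
  · refine tendsto_nhds_unique (hzlim' a) ?_
    simp [hz, hy, ha]
  · filter_upwards [hc.and (eventually_ge_atTop T), eventually_forall_ge_atTop.mpr hc] with t ht htT
    obtain ⟨ht, hTt⟩ := ht
    set k := e ^ (t - T) with hk
    have hk0 : (k : L) ≠ 0 := by
      rw [Nat.cast_ne_zero]; positivity
    have hzero : ∀ s, ∑ a, c a * δ a ^ e ^ t *
        (z s a * ∑ i ∈ Finset.range k, (1 + y s a) ^ i) = 0 := by
      intro s
      have h1 : ∀ a, y s a * ∑ i ∈ Finset.range k, (1 + y s a) ^ i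
          = δ a ^ (e ^ t * (e ^ u s - 1)) - 1 := by
        intro a
        have : 1 + y s a = δ a ^ (e ^ T * (e ^ u s - 1)) := by simp [hy]
        rw [mul_comm, this]
        change (∑ i ∈ Finset.range k, _) * (δ a ^ (e ^ T * (e ^ u s - 1)) - 1) = _
        rw [geom_sum_mul, ← pow_mul, hk]
        congr 2
        rw [mul_right_comm, ← pow_add, Nat.add_sub_cancel' hTt]
      have h2 : ∀ a, δ a ^ e ^ t * (δ a ^ (e ^ t * (e ^ u s - 1)) - 1)
          = δ a ^ e ^ (t + u s) - δ a ^ e ^ t := by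
        intro a
        rw [mul_sub, mul_one, ← pow_add, ← mul_one_add, pow_add,
          Nat.add_sub_cancel' (Nat.one_le_pow _ _ (by omega))]
      calc _ = (y s (m s))⁻¹ * ∑ a, (c a * δ a ^ e ^ (t + u s) - c a * δ a ^ e ^ t) := by
            rw [Finset.mul_sum]
            refine Finset.sum_congr rfl fun a _ => ?_
            rw [← mul_sub, ← h2, ← h1]
            simp only [hz]
            ring
        _ = 0 := by
            rw [Finset.sum_sub_distrib, ht, htT _ (Nat.le_add_right _ _)]; simp
    have hylim : ∀ a, Tendsto (fun s => y (ψ s) a) atTop (𝓝 0) := fun a => by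
      have := ((hlim T le_rfl a).comp hψ.tendsto_atTop).sub_const 1
      simpa [hy] using this
    have hslim : Tendsto (fun s => ∑ a, c a * δ a ^ e ^ t *
        (z (ψ s) a * ∑ i ∈ Finset.range k, (1 + y (ψ s) a) ^ i)) atTop
        (𝓝 (∑ a, c a * δ a ^ e ^ t * (μ a * ∑ i ∈ Finset.range k, (1 + 0) ^ i))) :=
      tendsto_finsetSum _ fun a _ => ((hzlim' a).mul
        (tendsto_finsetSum _ fun i _ => ((hylim a).const_add 1).pow i)).const_mul _
    have heq := tendsto_nhds_unique hslim (by simp only [hzero]; exact tendsto_const_nhds)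
    have : (∑ a, c a * μ a * δ a ^ e ^ t) * k = 0 := by
      rw [← heq, Finset.sum_mul]
      refine Finset.sum_congr rfl fun a _ => ?_
      simp
      ring
    exact (mul_eq_zero.mp this).resolve_right hk0

/-- An eventual relation persists when restricted to the terms of maximal absolute value. -/
lemma eventually_sum_dominant_eq_zero {ι L : Type*} [NormedField L] [ProperSpace L]
    [IsUltrametricDist L] {p e : ℕ} (hpp : p.Prime) (hp : ‖(p : L)‖ < 1)
    (hpe : p.Coprime e) (he : 2 ≤ e) (δ : ι → L) (S : Finset ι) (hδ : ∀ a ∈ S, ‖δ a‖ ≤ 1)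
    (c : ι → L) (hc : ∀ᶠ t : ℕ in atTop, ∑ a ∈ S, c a * δ a ^ e ^ t = 0) :
    ∀ᶠ t : ℕ in atTop, ∑ a ∈ S with ‖δ a‖ = 1, c a * δ a ^ e ^ t = 0 := by
  obtain ⟨T, u, hu, hlim⟩ := exists_powerMap_recurrence hpp hp hpe (by omega)
    (fun a : {a // a ∈ S.filter fun a => ‖δ a‖ = 1} => δ a)
    (fun a => (Finset.mem_filter.mp a.2).2)
  filter_upwards [eventually_ge_atTop T, eventually_forall_ge_atTop.mpr hc] with t hTt ht
  have hu_lim : Tendsto u atTop atTop :=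
    tendsto_atTop_mono (fun s => (hu s).le) tendsto_id
  have hterm : ∀ a ∈ S, Tendsto (fun s => c a * δ a ^ e ^ (t + u s)) atTop
      (𝓝 (if ‖δ a‖ = 1 then c a * δ a ^ e ^ t else 0)) := by
    intro a ha
    split_ifs with h
    · have := (hlim t hTt ⟨a, Finset.mem_filter.mpr ⟨ha, h⟩⟩).const_mul (c a * δ a ^ e ^ t)
      rw [mul_one] at this
      refine this.congr fun s => ?_
      rw [mul_assoc, ← pow_add, ← mul_one_add, Nat.add_sub_cancel' (Nat.one_le_pow _ _ (by omega)),
        pow_add]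
    · have hexp : Tendsto (fun s => e ^ (t + u s)) atTop atTop :=
        (tendsto_pow_atTop_atTop_of_one_lt (by omega)).comp
          (tendsto_atTop_mono (fun _ => Nat.le_add_left _ _) hu_lim)
      simpa using ((tendsto_pow_atTop_nhds_zero_of_norm_lt_one
        (lt_of_le_of_ne (hδ a ha) h)).comp hexp).const_mul (c a)
  have hsum := tendsto_finsetSum S hterm
  rw [← Finset.sum_filter] at hsum
  refine tendsto_nhds_unique hsum ?_
  simp only [ht _ (Nat.le_add_right _ _)]
  exact tendsto_const_nhds

lemma coeff_eq_zero_of_eventually_sum_eq_zero {ι L : Type*} [NormedField L] [ProperSpace L]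
    [IsUltrametricDist L] [CharZero L] {p e : ℕ} (hpp : p.Prime) (hp : ‖(p : L)‖ < 1)
    (hpe : p.Coprime e) (he : 2 ≤ e) (γ : ι → L) (hγ0 : ∀ a, γ a ≠ 0)
    (hγ : ∀ a b, a ≠ b → ∀ k > 0, γ a ^ k ≠ γ b ^ k) (S : Finset ι) (c : ι → L)
    (hc : ∀ᶠ t : ℕ in atTop, ∑ a ∈ S, c a * γ a ^ e ^ t = 0) : ∀ a ∈ S, c a = 0 := by
  classical
  induction S using Finset.strongInduction generalizing c with
  | H S ih =>
  by_contra! hex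
  have hall : ∀ a ∈ S, c a ≠ 0 := by
    intro a ha h0
    obtain ⟨b, hb, hb0⟩ := hex
    refine hb0 (ih (S.erase a) (Finset.erase_ssubset ha) c ?_ b ?_)
    · filter_upwards [hc] with t ht
      rw [← ht, ← Finset.add_sum_erase S _ ha, h0, zero_mul, zero_add]
    · exact Finset.mem_erase.mpr ⟨fun h => hb0 (h ▸ h0), hb⟩
  obtain ⟨o, hoS, ho⟩ := S.exists_max_image (fun a => ‖γ a‖) ⟨_, hex.choose_spec.1⟩
  have ho0 : 0 < ‖γ o‖ := norm_pos_iff.mpr (hγ0 o)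
  set δ : ι → L := fun a => γ a / γ o with hδ
  have hscale : ∀ (R : Finset ι) (b : ι → L) (t : ℕ),
      ∑ a ∈ R, b a * γ a ^ e ^ t = 0 ↔ ∑ a ∈ R, b a * δ a ^ e ^ t = 0 := by
    intro R b t
    have : ∑ a ∈ R, b a * γ a ^ e ^ t = (∑ a ∈ R, b a * δ a ^ e ^ t) * γ o ^ e ^ t := by
      rw [Finset.sum_mul]
      refine Finset.sum_congr rfl fun a _ => ?_
      rw [mul_assoc, ← mul_pow, hδ, div_mul_cancel₀ _ (hγ0 o)]
    rw [this, mul_eq_zero, or_iff_left (pow_ne_zero _ (hγ0 o))]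
  have hδ1 : ∀ a ∈ S, ‖δ a‖ ≤ 1 := fun a ha => by
    rw [hδ, norm_div]; exact div_le_one_of_le₀ (ho a ha) ho0.le
  have hδo : δ o = 1 := div_self (hγ0 o)
  have hdom := eventually_sum_dominant_eq_zero hpp hp hpe he δ S hδ1 c
    (hc.mono fun t ht => (hscale S c t).mp ht)
  have hnorm : S.filter (fun a => ‖δ a‖ = 1) = S := by
    by_contra hne
    exact hall o hoS (ih _ ((Finset.filter_subset _ S).ssubset_of_ne hne) c
      (hdom.mono fun t ht => (hscale _ c t).mpr ht) o
      (Finset.mem_filter.mpr ⟨hoS, by simp [hδo]⟩))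
  have hδS : ∀ a ∈ S, ‖δ a‖ = 1 := fun a ha => by
    rw [← hnorm] at ha; exact (Finset.mem_filter.mp ha).2
  by_cases hS : ∃ b ∈ S, b ≠ o
  · obtain ⟨b, hbS, hbo⟩ := hS
    obtain ⟨μ, ⟨x, hx⟩, hμ1, hμ⟩ := exists_coeff_multiplier hpp hp hpe he
      (fun a : {a // a ∈ S} => δ a) (fun a => hδS a a.2) ⟨⟨b, hbS⟩, fun k hk h => by
        rw [hδ, div_pow, div_eq_one_iff_eq (pow_ne_zero _ (hγ0 o))] at h
        exact hγ b o hbo k hk h⟩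
    have hxo : (x : ι) ≠ o := fun h => hx (hμ1 x (by rw [h, hδo]))
    have hrel := hμ (fun a => c a) (hc.mono fun t ht => by
      rw [hscale, ← Finset.sum_coe_sort] at ht; exact ht)
    set ν : ι → L := fun a => if h : a ∈ S then c a * μ ⟨a, h⟩ else 0 with hν
    have hνo : ν o = 0 := by
      simp only [hν, hoS, dif_pos]
      rw [hμ1 ⟨o, hoS⟩ hδo, mul_zero]
    have hνx := ih (S.erase o) (Finset.erase_ssubset hoS) ν (hrel.mono fun t ht => by
      rw [hscale, ← ht, ← zero_add (∑ a ∈ S.erase o, _), ← zero_mul (δ o ^ e ^ t), ← hνo,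
        Finset.add_sum_erase S (fun a => ν a * δ a ^ e ^ t) hoS, ← Finset.sum_coe_sort]
      refine Finset.sum_congr rfl fun a _ => ?_
      simp [hν]) x (Finset.mem_erase.mpr ⟨hxo, x.2⟩)
    simp only [hν, x.2, dif_pos] at hνx
    exact (mul_ne_zero (hall x x.2) hx) hνx
  · push Not at hS
    obtain ⟨t, ht⟩ := hc.exists
    rw [Finset.sum_eq_single_of_mem o hoS fun b hb hbo => absurd (hS b hb) hbo] at ht
    exact mul_ne_zero (hall o hoS) (pow_ne_zero _ (hγ0 o)) ht

/-- A countable field of characteristic zero embeds into every uncountable algebraically closed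
field of characteristic zero. -/
lemma nonempty_ringHom_of_countable.{u, v} (F : Type u) (Ω : Type v) [Field F] [Field Ω] [CharZero F]
    [CharZero Ω] [IsAlgClosed Ω] [Countable F] (hΩ : Cardinal.aleph0 < Cardinal.mk Ω) :
    Nonempty (F →+* Ω) := by
  let R := MvPolynomial Ω F
  let Q := FractionRing R
  let A := AlgebraicClosure Q
  have : CharZero A := charZero_of_injective_algebraMap (algebraMap F A).injective
  have hR : Cardinal.mk R ≤ Cardinal.lift.{u} (Cardinal.mk Ω) := by
    refine MvPolynomial.cardinalMk_le_max_lift.trans (max_le (max_le ?_ le_rfl) ?_)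
    · exact (Cardinal.lift_le_aleph0.mpr (Cardinal.mk_le_aleph0_iff.mpr ‹_›)).trans
        (Cardinal.aleph0_le_lift.mpr hΩ.le)
    · exact Cardinal.aleph0_le_lift.mpr hΩ.le
  have hup : Cardinal.mk A ≤ Cardinal.lift.{u} (Cardinal.mk Ω) := by
    refine (Algebra.IsAlgebraic.cardinalMk_le_max Q A).trans (max_le ?_ ?_)
    · exact (IsFractionRing.cardinalMk R Q).trans_le hR
    · exact Cardinal.aleph0_le_lift.mpr hΩ.le
  have hlow : Cardinal.lift.{u} (Cardinal.mk Ω) ≤ Cardinal.mk A := by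
    have hinj : Function.Injective fun x : ULift.{u} Ω =>
        algebraMap Q A (algebraMap R Q (MvPolynomial.X x.down)) :=
      (algebraMap Q A).injective.comp
        ((IsFractionRing.injective R Q).comp
          ((MvPolynomial.X_injective (R := F)).comp ULift.down_injective))
    simpa using Cardinal.mk_le_of_injective hinj
  have hcard : Cardinal.lift.{max u v} (Cardinal.mk Ω) = Cardinal.lift.{v} (Cardinal.mk A) := by
    rw [← hlow.antisymm hup]
    simp
  obtain ⟨f⟩ := IsAlgClosed.ringEquiv_of_equiv_of_charZero hΩ (Cardinal.lift_mk_eq'.mp hcard)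
  exact ⟨f.symm.toRingHom.comp (algebraMap F A)⟩

lemma coeff_eq_zero_of_eventually_sum_eq_zero_of_charZero {ι K : Type*} [Field K] [CharZero K]
    {e : ℕ} (he : 2 ≤ e) (γ : ι → K) (hγ0 : ∀ a, γ a ≠ 0)
    (hγ : ∀ a b, a ≠ b → ∀ k > 0, γ a ^ k ≠ γ b ^ k) (S : Finset ι) (c : ι → K)
    (hc : ∀ᶠ t : ℕ in atTop, ∑ a ∈ S, c a * γ a ^ e ^ t = 0) : ∀ a ∈ S, c a = 0 := by
  obtain ⟨p, hep, hpp⟩ := Nat.exists_infinite_primes (e + 1)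
  have : Fact p.Prime := ⟨hpp⟩
  have hpe : p.Coprime e := (Nat.coprime_of_lt_prime (by omega) (by omega) hpp)
  let X : Set K := γ '' S ∪ c '' S
  have hX : X.Finite := (S.finite_toSet.image _).union (S.finite_toSet.image _)
  let F := Subfield.closure X
  have : Countable F := by
    rw [← Cardinal.mk_le_aleph0_iff]
    exact (Subfield.cardinalMk_closure_le_max X).trans
      (max_le (Cardinal.mk_le_aleph0_iff.mpr hX.countable.to_subtype) le_rfl)
  have hΩ : Cardinal.aleph0 < Cardinal.mk (PadicAlgCl p) :=
    (Cardinal.aleph0_lt_continuum.trans_le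
      (continuum_le_cardinal_of_nontriviallyNormedField ℚ_[p])).trans_le
      (Cardinal.mk_le_of_injective (algebraMap ℚ_[p] (PadicAlgCl p)).injective)
  obtain ⟨f⟩ := nonempty_ringHom_of_countable F (PadicAlgCl p) hΩ
  let Y : Set (PadicAlgCl p) := f '' (Subtype.val ⁻¹' X)
  have hY : Y.Finite := (hX.preimage Subtype.val_injective.injOn).image _
  let L := IntermediateField.adjoin ℚ_[p] Y
  have : Finite Y := hY
  have : FiniteDimensional ℚ_[p] L :=
    IntermediateField.finiteDimensional_adjoin fun x _ => Algebra.IsIntegral.isIntegral x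
  have : ProperSpace L := FiniteDimensional.proper ℚ_[p] L
  have : IsUltrametricDist L := IsUltrametricDist.of_normedAlgebra ℚ_[p]
  have : CharZero L := charZero_of_injective_algebraMap (algebraMap ℚ_[p] L).injective
  have hpL : ‖(p : L)‖ < 1 := by
    rw [← map_natCast (algebraMap ℚ_[p] L), norm_algebraMap']
    exact Padic.norm_p_lt_one
  have hγF : ∀ a : S, γ a ∈ F := fun a =>
    Subfield.subset_closure (Or.inl ⟨a, a.2, rfl⟩)
  have hcF : ∀ a : S, c a ∈ F := fun a =>
    Subfield.subset_closure (Or.inr ⟨a, a.2, rfl⟩)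
  have hγL : ∀ a : S, f ⟨γ a, hγF a⟩ ∈ L := fun a =>
    IntermediateField.subset_adjoin _ _ ⟨_, Or.inl ⟨a, a.2, rfl⟩, rfl⟩
  have hcL : ∀ a : S, f ⟨c a, hcF a⟩ ∈ L := fun a =>
    IntermediateField.subset_adjoin _ _ ⟨_, Or.inr ⟨a, a.2, rfl⟩, rfl⟩
  have key := coeff_eq_zero_of_eventually_sum_eq_zero hpp hpL hpe he
    (fun a : S => (⟨f ⟨γ a, hγF a⟩, hγL a⟩ : L)) (fun a h => by
      have h1 : f ⟨γ a, hγF a⟩ = 0 := congrArg Subtype.val h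
      rw [map_eq_zero] at h1
      exact hγ0 a (congrArg Subtype.val h1))
    (fun a b hab k hk h => by
      have h1 : f ⟨γ a, hγF a⟩ ^ k = f ⟨γ b, hγF b⟩ ^ k := congrArg Subtype.val h
      rw [← map_pow, ← map_pow] at h1
      exact hγ a b (Subtype.val_injective.ne hab) k hk (congrArg Subtype.val (f.injective h1)))
    Finset.univ (fun a : S => (⟨f ⟨c a, hcF a⟩, hcL a⟩ : L)) (hc.mono fun t ht => by
      have h1 : ∑ a : S, (⟨c a, hcF a⟩ : F) * ⟨γ a, hγF a⟩ ^ e ^ t = 0 := by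
        apply Subtype.val_injective
        rw [← Finset.sum_coe_sort] at ht
        simpa using ht
      apply Subtype.val_injective
      have h2 := congrArg f h1
      simp only [map_sum, map_mul, map_pow, map_zero] at h2
      simpa using h2)
  intro a ha
  have h1 : f ⟨c a, hcF ⟨a, ha⟩⟩ = 0 := congrArg Subtype.val (key ⟨a, ha⟩ (Finset.mem_univ _))
  rw [map_eq_zero] at h1
  exact congrArg Subtype.val h1

/-- The orbit of a multiplicatively independent point under a power map is Zariski dense. -/
lemma exists_eval_pow_ne_zero {σ K : Type*} [Fintype σ] [Field K] [CharZero K] {e b : ℕ}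
    (he : 2 ≤ e) (hb : 0 < b) (x : σ → K) (hx0 : ∀ j, x j ≠ 0)
    (hx : ∀ v : σ → ℤ, ∏ j, x j ^ v j = 1 → v = 0) {F : MvPolynomial σ K} (hF : F ≠ 0) :
    ∃ t, MvPolynomial.eval (fun j => x j ^ (b * e ^ t)) F ≠ 0 := by
  by_contra! h
  obtain ⟨m, hm⟩ := MvPolynomial.support_nonempty.mpr hF
  refine MvPolynomial.mem_support_iff.mp hm
    (coeff_eq_zero_of_eventually_sum_eq_zero_of_charZero he
      (fun m : σ →₀ ℕ => ∏ j, x j ^ (b * m j))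
      (fun m => Finset.prod_ne_zero_iff.mpr fun j _ => pow_ne_zero _ (hx0 j)) ?_ F.support
      (fun m => F.coeff m) (Eventually.of_forall fun t => ?_) m hm)
  · intro m m' hne k hk heq
    refine hne (Finsupp.ext fun j => ?_)
    have h1 := hx (fun j => ((b * m j * k : ℕ) : ℤ) - ((b * m' j * k : ℕ) : ℤ)) (by
      simp_rw [zpow_sub₀ (hx0 _), zpow_natCast, Finset.prod_div_distrib, pow_mul _ _ k,
        Finset.prod_pow]
      rw [heq]
      exact div_self (pow_ne_zero _ (Finset.prod_ne_zero_iff.mpr fun j _ =>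
        pow_ne_zero _ (hx0 j))))
    have h2 : b * m j * k = b * m' j * k := by
      have := congrFun h1 j
      simp only [Pi.zero_apply] at this
      omega
    exact Nat.eq_of_mul_eq_mul_left hb (Nat.eq_of_mul_eq_mul_right hk h2)
  · rw [← h t, MvPolynomial.eval_eq']
    refine Finset.sum_congr rfl fun m _ => ?_
    rw [← Finset.prod_pow]
    simp_rw [← pow_mul]
    congr 1
    exact Finset.prod_congr rfl fun j _ => by ring

/-- If the values of a sequence avoid any finite union of proper subspaces of `W`, then arbitrarily
many of them are in general position. -/
lemma exists_generalPosition {K E : Type*} [Field K] [AddCommGroup E] [Module K E]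
    {W : Submodule K E} [FiniteDimensional K W] {n : ℕ} (hn : 2 ≤ n)
    (hW : Module.finrank K W = n) (v : ℕ → E) (hv : ∀ t, v t ∈ W)
    (hav : ∀ 𝒰 : Finset (Submodule K E), (∀ U ∈ 𝒰, U < W) → ∃ t, ∀ U ∈ 𝒰, v t ∉ U) (k : ℕ) :
    ∃ T : Finset ℕ, T.card = k ∧ ∀ S ⊆ T, S.card ≤ n → LinearIndepOn K v (S : Set ℕ) := by
  classical
  induction k with
  | zero =>
    refine ⟨∅, rfl, fun S hS _ => ?_⟩
    rw [Finset.subset_empty.mp hS, Finset.coe_empty]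
    exact linearIndepOn_empty K v
  | succ k ih =>
    obtain ⟨T, hT, hTn⟩ := ih
    obtain ⟨t, ht⟩ := hav
      ((T.powerset.filter fun S => S.card < n).image
        fun S : Finset ℕ => Submodule.span K (v '' (S : Set ℕ))) (by
        intro U hU
        obtain ⟨S, hS, rfl⟩ := Finset.mem_image.mp hU
        refine lt_of_le_of_ne (Submodule.span_le.mpr ?_) fun heq => ?_
        · rintro _ ⟨s, -, rfl⟩
          exact hv s
        · have h1 := finrank_span_finset_le_card (R := K) (S.image v)
          rw [Finset.coe_image, Set.finrank, heq, hW] at h1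
          have h2 := (Finset.mem_filter.mp hS).2
          have h3 := Finset.card_image_le (s := S) (f := v)
          omega)
    have ht' : ∀ S ⊆ T, S.card < n → v t ∉ Submodule.span K (v '' (S : Set ℕ)) := fun S hS hc =>
      ht _ (Finset.mem_image.mpr ⟨S, Finset.mem_filter.mpr ⟨Finset.mem_powerset.mpr hS, hc⟩, rfl⟩)
    have htT : t ∉ T := fun h => ht' {t} (Finset.singleton_subset_iff.mpr h)
      (by rw [Finset.card_singleton]; omega) (Submodule.subset_span ⟨t, by simp, rfl⟩)
    refine ⟨insert t T, by rw [Finset.card_insert_of_notMem htT, hT], fun S hS hc => ?_⟩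
    by_cases hmem : t ∈ S
    · have hsub : S.erase t ⊆ T := fun s hs =>
        (Finset.mem_insert.mp (hS (Finset.mem_of_mem_erase hs))).resolve_left
          (Finset.ne_of_mem_erase hs)
      have hcard : (S.erase t).card < n := (Finset.card_erase_lt_of_mem hmem).trans_le hc
      rw [← Finset.insert_erase hmem, Finset.coe_insert]
      exact (hTn _ hsub hcard.le).insert (ht' _ hsub hcard)
    · exact hTn S ((Finset.subset_insert_iff_of_notMem hmem).mp hS) hc

lemma superSpans_of_generalPosition {K : Type*} [Field K] {n r : ℕ}
    {W : Submodule K (Fin (n + 1) → K)} (hW : Module.finrank K W = r)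
    (v : ℕ → Fin (n + 1) → K) (hv : ∀ t, v t ∈ W) {T : Finset ℕ} (hT : T.card = r + 1)
    (hind : ∀ S ⊆ T, S.card ≤ r → LinearIndepOn K v (S : Set ℕ)) :
    SuperSpans W fun i => v (T.orderEmbOfFin hT i) := by
  refine ⟨fun i => hv _, fun i => ?_⟩
  have hi := T.orderEmbOfFin_mem hT i
  have hset : {w | ∃ j, j ≠ i ∧ w = v (T.orderEmbOfFin hT j)}
      = v '' (T.erase (T.orderEmbOfFin hT i) : Set ℕ) := by
    ext w
    constructor
    · rintro ⟨j, hj, rfl⟩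
      exact ⟨_, by simp [hj], rfl⟩
    · rintro ⟨s, hs, rfl⟩
      obtain ⟨hsi, hsT⟩ := Finset.mem_erase.mp hs
      rw [← Finset.mem_coe, ← T.range_orderEmbOfFin hT] at hsT
      obtain ⟨j, rfl⟩ := hsT
      exact ⟨j, fun h => hsi (h ▸ rfl), rfl⟩
  have hcard : (T.erase (T.orderEmbOfFin hT i)).card = r := by
    rw [Finset.card_erase_of_mem hi, hT, Nat.add_sub_cancel]
  rw [hset]
  refine Submodule.eq_of_le_of_finrank_eq (Submodule.span_le.mpr ?_) ?_
  · rintro _ ⟨s, -, rfl⟩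
    exact hv s
  · have := (hind _ (Finset.erase_subset _ _) hcard.le)
    rw [Set.image_eq_range]
    rw [finrank_span_eq_card this, hW]
    simpa using hcard

lemma finrank_ker_proj_sub_smul_proj {K : Type*} [Field K] {n : ℕ} (hn : 1 ≤ n) (z : K) :
    Module.finrank K (LinearMap.ker ((LinearMap.proj 1 : (Fin (n + 1) → K) →ₗ[K] K)
      - z • (LinearMap.proj 0 : (Fin (n + 1) → K) →ₗ[K] K))) = n := by
  obtain ⟨n, rfl⟩ := Nat.exists_eq_add_of_le' hn
  set g := (LinearMap.proj 1 : (Fin (n + 1 + 1) → K) →ₗ[K] K)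
    - z • (LinearMap.proj 0 : (Fin (n + 1 + 1) → K) →ₗ[K] K) with hg
  have hne : g ≠ 0 := fun h => by
    have := LinearMap.congr_fun h (Pi.single 1 1)
    simp [hg] at this
  have hr := g.finrank_range_add_finrank_ker
  rw [LinearMap.range_eq_top.mpr (LinearMap.surjective hne), finrank_top, Module.finrank_self,
    Module.finrank_fin_fun] at hr
  omega

/-- A sequence on the hyperplane `x₁ = z x₀` whose remaining coordinates are Zariski dense avoids
any finite union of proper subspaces of that hyperplane. -/
lemma exists_avoiding_subspaces {K : Type*} [Field K] {n : ℕ} (z : K) (y : ℕ → Fin n → K)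
    (hy : ∀ F : MvPolynomial (Fin n) K, F ≠ 0 → ∃ t, MvPolynomial.eval (y t) F ≠ 0)
    (v : ℕ → Fin (n + 1 + 1) → K) (hv0 : ∀ t, v t 0 = 1) (hv1 : ∀ t, v t 1 = z)
    (hvy : ∀ t j, v t j.succ.succ = y t j) (𝒰 : Finset (Submodule K (Fin (n + 1 + 1) → K)))
    (h𝒰 : ∀ U ∈ 𝒰, U < LinearMap.ker ((LinearMap.proj 1 : (Fin (n + 1 + 1) → K) →ₗ[K] K)
      - z • (LinearMap.proj 0 : (Fin (n + 1 + 1) → K) →ₗ[K] K))) :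
    ∃ t, ∀ U ∈ 𝒰, v t ∉ U := by
  have key : ∀ U ∈ 𝒰, ∃ F : MvPolynomial (Fin n) K, F ≠ 0 ∧
      ∀ t, v t ∈ U → MvPolynomial.eval (y t) F = 0 := by
    intro U hU
    obtain ⟨w, hwW, hwU⟩ := SetLike.exists_of_lt (h𝒰 U hU)
    obtain ⟨f, hfw, hf⟩ := Submodule.exists_le_ker_of_notMem hwU
    have hfx : ∀ x : Fin (n + 1 + 1) → K, f x = x 0 * f (Pi.single 0 1) + (x 1 * f (Pi.single 1 1)
        + ∑ j : Fin n, x j.succ.succ * f (Pi.single j.succ.succ 1)) := fun x => by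
      rw [LinearMap.pi_apply_eq_sum_univ f x, Fin.sum_univ_succ, Fin.sum_univ_succ]
      have hs : ∀ i : Fin (n + 1 + 1),
          (fun j => if i = j then (1 : K) else 0) = Pi.single i 1 := fun i => by
        ext j; simp [Pi.single_apply, eq_comm]
      simp only [hs, smul_eq_mul]
      rfl
    let F : MvPolynomial (Fin n) K := MvPolynomial.C (f (Pi.single 0 1) + z * f (Pi.single 1 1))
      + ∑ j : Fin n, MvPolynomial.C (f (Pi.single j.succ.succ 1)) * MvPolynomial.X j
    have hF : ∀ u : Fin n → K, MvPolynomial.eval u F = f (Pi.single 0 1) + z * f (Pi.single 1 1)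
        + ∑ j : Fin n, u j * f (Pi.single j.succ.succ 1) := fun u => by
      simp [F, mul_comm]
    refine ⟨F, fun h0 => hfw ?_, fun t ht => ?_⟩
    · have hw1 : w 1 = z * w 0 := by
        simpa [sub_eq_zero] using hwW
      have hc := hF 0
      have hj : ∀ j : Fin n, f (Pi.single j.succ.succ 1) = 0 := fun j => by
        have h1 := hF (Pi.single j 1)
        rw [h0, map_zero] at h1 hc
        simp only [Pi.zero_apply, zero_mul, Finset.sum_const_zero, add_zero] at hc
        rw [← hc, zero_add] at h1
        simpa [Pi.single_apply] using h1.symm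
      rw [h0, map_zero] at hc
      simp only [Pi.zero_apply, zero_mul, Finset.sum_const_zero, add_zero] at hc
      rw [hfx, hw1]
      simp only [hj, mul_zero, Finset.sum_const_zero, add_zero]
      linear_combination -w 0 * hc
    · have h0 : f (v t) = 0 := hf ht
      rw [hfx, hv0, hv1] at h0
      simp only [hvy] at h0
      rw [hF]
      linear_combination h0
  choose! F hF0 hF using key
  obtain ⟨t, ht⟩ := hy (∏ U ∈ 𝒰, F U) (Finset.prod_ne_zero_iff.mpr hF0)
  refine ⟨t, fun U hU hmem => ht ?_⟩
  rw [map_prod]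
  exact Finset.prod_eq_zero hU (hF U hU t hmem)

/-- Every nonzero residue modulo a prime is congruent to a power of a primitive root. -/
lemma exists_pow_modEq_of_orderOf_eq {ℓ d i : ℕ} (hℓ : ℓ.Prime)
    (hprim : orderOf (d : ZMod ℓ) = ℓ - 1) (hi0 : 0 < i) (hiℓ : i < ℓ) :
    ∃ a : ℕ, d ^ a ≡ i [MOD ℓ] := by
  have : Fact ℓ.Prime := ⟨hℓ⟩
  have hℓ1 : 0 < ℓ - 1 := Nat.sub_pos_of_lt hℓ.one_lt
  have hfin : IsOfFinOrder (d : ZMod ℓ) := orderOf_pos_iff.mp (hprim ▸ hℓ1)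
  have hi : (i : ZMod ℓ) ≠ 0 := by
    rw [Ne, ZMod.natCast_eq_zero_iff]
    exact Nat.not_dvd_of_pos_of_lt hi0 hiℓ
  obtain ⟨D, hD⟩ := hfin.isUnit
  have hcard : Nat.card (Subgroup.zpowers D) = Nat.card (ZMod ℓ)ˣ := by
    rw [Nat.card_zpowers, ← orderOf_units, hD, hprim, Nat.card_eq_fintype_card, ZMod.card_units]
  have htop : Subgroup.zpowers D = ⊤ := Subgroup.eq_top_of_card_eq _ hcard
  have hmem : Units.mk0 (i : ZMod ℓ) hi ∈ Subgroup.zpowers D := htop ▸ Subgroup.mem_top _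
  obtain ⟨a, ha⟩ := mem_powers_iff_mem_zpowers.mpr hmem
  refine ⟨a, (ZMod.natCast_eq_natCast_iff _ _ _).mp ?_⟩
  have := congrArg Units.val ha
  simpa [hD] using this

/-- with `P = [1 : ζ : α_2 : ⋯ : α_n]`, `ζ` a primitive `ℓ`-th root of
unity, `d` a primitive root modulo the prime `ℓ ≥ 3`, and `α_2, …, α_n` multiplicatively
independent, every hyperplane `H_i = {x_1 = ζ^i x_0}` with `0 < i < ℓ` is an exceptional
hyperplane for the `d`-th power map and `P`. -/
theorem stmt10 {K : Type*} [Field K] [IsAlgClosed K] [CharZero K]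
    (n d : ℕ) (hn : 2 ≤ n) (hd : 2 ≤ d)
    (ℓ : ℕ) (hℓ : ℓ.Prime) (hℓ3 : 3 ≤ ℓ)
    (hprim : orderOf ((d : ZMod ℓ)) = ℓ - 1)
    (ζ : K) (hζ : IsPrimitiveRoot ζ ℓ)
    (α : Fin (n + 1) → K) (hα0 : α 0 = 1) (hα1 : α 1 = ζ) (hαnz : ∀ i, α i ≠ 0)
    (hindep : ∀ e : Fin (n + 1) → ℤ, e 0 = 0 → e 1 = 0 →
      (∏ i, α i ^ e i) = 1 → e = 0)
    (i : ℕ) (hi0 : 0 < i) (hiℓ : i < ℓ) :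
    LinearMap.ker ((LinearMap.proj 1 : (Fin (n + 1) → K) →ₗ[K] K)
        - ζ ^ i • (LinearMap.proj 0 : (Fin (n + 1) → K) →ₗ[K] K))
      ∈ exceptionalSubspaces α d n := by
  obtain ⟨n, rfl⟩ := Nat.exists_eq_add_of_le' (show 1 ≤ n by omega)
  obtain ⟨a, ha⟩ := exists_pow_modEq_of_orderOf_eq hℓ hprim hi0 hiℓ
  set m : ℕ → ℕ := fun t => a + (ℓ - 1) * t with hm
  have hdm : ∀ t, d ^ m t = d ^ a * (d ^ (ℓ - 1)) ^ t := fun t => by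
    rw [hm, pow_add, pow_mul]
  have hζm : ∀ t, ζ ^ d ^ m t = ζ ^ i := fun t => by
    have h1 : d ^ (ℓ - 1) ≡ 1 [MOD ℓ] := by
      rw [← ZMod.natCast_eq_natCast_iff, Nat.cast_pow, ← hprim, pow_orderOf_eq_one, Nat.cast_one]
    have h2 : d ^ m t ≡ i [MOD ℓ] := by
      rw [hdm]
      simpa using ha.mul (h1.pow t)
    rw [pow_eq_pow_mod _ hζ.pow_eq_one, show _ % _ = _ % _ from h2, ← pow_eq_pow_mod _ hζ.pow_eq_one]
  have he : 2 ≤ d ^ (ℓ - 1) := hd.trans (Nat.le_self_pow (by omega) d)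
  have hdense := fun F hF => exists_eval_pow_ne_zero (F := F) he
    (Nat.pow_pos (n := a) (show 0 < d by omega)) (fun j : Fin n => α j.succ.succ)
    (fun j => hαnz _) (fun v hv => by
      have := hindep (Fin.cons 0 (Fin.cons 0 v)) rfl rfl (by
        simpa [Fin.prod_univ_succ] using hv)
      exact funext fun j => congrFun this j.succ.succ) hF
  have hv0 : ∀ t, orbitVec α d (m t) 0 = 1 := fun t => by simp [orbitVec, hα0]
  have hv1 : ∀ t, orbitVec α d (m t) 1 = ζ ^ i := fun t => by simp only [orbitVec, hα1, hζm]
  have hW := finrank_ker_proj_sub_smul_proj (n := n + 1) (by omega) (ζ ^ i)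
  have hmem : ∀ t, orbitVec α d (m t) ∈
      LinearMap.ker ((LinearMap.proj 1 : (Fin (n + 1 + 1) → K) →ₗ[K] K)
        - ζ ^ i • (LinearMap.proj 0 : (Fin (n + 1 + 1) → K) →ₗ[K] K)) := fun t => by
    simp [hv0, hv1]
  obtain ⟨T, hT, hTn⟩ := exists_generalPosition hn hW (fun t => orbitVec α d (m t)) hmem
    (exists_avoiding_subspaces (ζ ^ i) _ hdense _ hv0 hv1
      fun t j => by simp only [orbitVec, hdm]) (n + 1 + 1)
  exact ⟨hW, _, superSpans_of_generalPosition hW _ hmem hT hTn⟩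

end
end

section
/- Let n ≥ 2 and let d ≥ 2 be an integer that is a primitive root modulo infinitely many primes. Then for every B ∈ ℕ there exists a point P ∈ ℙⁿ(ℂ) with all coordinates nonzero such that #𝓛^n_{φ_d,P} ≥ B. Consequently, if one drops the hypothesis R(P) = {0}, there is no bound for the number of exceptional hyperplanes #𝓛^n_{φ_d,P} that depends only on n and d, independent of the point P. -/
open scoped BigOperators

noncomputable section

/-- The graph embedding `w ↦ (c w₀, w₀, …, w_k)` of `K^{k+1}` as the hyperplane `z₀ = c z₁`. -/
def consSmulHead {K : Type*} [Field K] {k : ℕ} (c : K) :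
    (Fin (k + 1) → K) →ₗ[K] (Fin (k + 1 + 1) → K) where
  toFun w := Fin.cons (c * w 0) w
  map_add' v w := by
    ext j
    refine Fin.cases ?_ (fun j => ?_) j <;> simp [mul_add]
  map_smul' a w := by
    ext j
    refine Fin.cases ?_ (fun j => ?_) j <;> simp [mul_left_comm]

theorem consSmulHead_injective {K : Type*} [Field K] {k : ℕ} (c : K) :
    Function.Injective (consSmulHead (k := k) c) := fun v w h => by
  funext j
  simpa [consSmulHead] using congrFun h j.succ

theorem range_consSmulHead_injective {K : Type*} [Field K] {k : ℕ} :
    Function.Injective fun c : K => LinearMap.range (consSmulHead (k := k) c) := by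
  intro c c' h
  have hmem : consSmulHead (k := k) c 1 ∈ LinearMap.range (consSmulHead (k := k) c') := by
    beta_reduce at h
    exact h ▸ LinearMap.mem_range_self _ _
  obtain ⟨w, hw⟩ := hmem
  have h0 := congrFun hw 0
  have h1 := congrFun hw (Fin.succ 0)
  simp only [consSmulHead, LinearMap.coe_mk, AddHom.coe_mk, Fin.cons_zero, Fin.cons_succ,
    Pi.one_apply, mul_one] at h0 h1
  rw [← h0, h1, mul_one]

/-- Points of the moment curve with distinct parameters span the whole space. -/
theorem span_range_powers_eq_top {K : Type*} [Field K] {n : ℕ} {x : Fin n → K}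
    (hx : Function.Injective x) :
    Submodule.span K (Set.range fun i => (fun j : Fin n => x i ^ (j : ℕ))) = ⊤ := by
  have hli : LinearIndependent K (Matrix.vandermonde x).row :=
    Matrix.linearIndependent_rows_of_det_ne_zero (Matrix.det_vandermonde_ne_zero_iff.mpr hx)
  exact hli.span_eq_top_of_card_eq_finrank' (by simp)

/-- If the orbit of `[c₀ : 1 : t : ⋯ : t^k]` meets the hyperplane `z₀ = c z₁` in `k + 2` points with
distinct parameters, then that hyperplane is exceptional. -/
theorem range_consSmulHead_mem_exceptionalSubspaces {K : Type*} [Field K] {k d : ℕ} {c₀ c t : K}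
    (m : Fin (k + 1 + 1) → ℕ) (hc : ∀ i, c₀ ^ d ^ m i = c)
    (ht : Function.Injective fun i => t ^ d ^ m i) :
    LinearMap.range (consSmulHead (k := k) c) ∈
      exceptionalSubspaces (Fin.cons c₀ fun j : Fin (k + 1) => t ^ (j : ℕ)) d (k + 1) := by
  have horbit : ∀ i, orbitVec (Fin.cons c₀ fun j : Fin (k + 1) => t ^ (j : ℕ)) d (m i) =
      consSmulHead c fun j : Fin (k + 1) => (t ^ d ^ m i) ^ (j : ℕ) := by
    intro i
    ext j
    refine Fin.cases ?_ (fun j => ?_) j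
    · simp [orbitVec, consSmulHead, hc]
    · simp [orbitVec, consSmulHead, pow_right_comm]
  refine ⟨?_, m, ?_, ?_⟩
  · rw [LinearMap.finrank_range_of_inj (consSmulHead_injective c)]
    simp
  · intro i
    exact ⟨_, (horbit i).symm⟩
  · intro i
    have hset : {v | ∃ j, j ≠ i ∧
          v = orbitVec (Fin.cons c₀ fun j : Fin (k + 1) => t ^ (j : ℕ)) d (m j)} =
        consSmulHead c '' Set.range fun l : Fin (k + 1) =>
          (fun j : Fin (k + 1) => (t ^ d ^ m (i.succAbove l)) ^ (j : ℕ)) := by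
      ext v
      simp only [Set.mem_ofPred_eq, Set.mem_image, Set.exists_range_iff, horbit]
      constructor
      · rintro ⟨j, hj, rfl⟩
        obtain ⟨l, rfl⟩ := Fin.exists_succAbove_eq hj
        exact ⟨l, rfl⟩
      · rintro ⟨l, rfl⟩
        exact ⟨i.succAbove l, Fin.succAbove_ne i l, rfl⟩
    rw [hset, Submodule.span_image,
      span_range_powers_eq_top (x := fun l => t ^ d ^ m (i.succAbove l))
        (ht.comp Fin.succAbove_right_injective), Submodule.map_top]

theorem pow_pow_add_mul_eq {M : Type*} [Monoid M] {ζ : M} {d N : ℕ} (h : ζ ^ d ^ N = ζ)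
    (b i : ℕ) : ζ ^ d ^ (b + N * i) = ζ ^ d ^ b := by
  induction i with
  | zero => simp
  | succ i ih =>
    rw [show b + N * (i + 1) = N + (b + N * i) by ring, pow_add, pow_mul, h, ih]

/-- if `d ≥ 2` is a primitive root modulo infinitely many primes, then for
every `B` there is a point `P ∈ ℙⁿ(ℂ)` with nonzero coordinates having at least `B`
exceptional hyperplanes; so no bound depending only on `n` and `d` is possible once the
hypothesis `R(P) = {0}` is dropped. -/
theorem stmt11 (n d : ℕ) (hn : 2 ≤ n) (hd : 2 ≤ d)
    (hinf : {ℓ : ℕ | ℓ.Prime ∧ orderOf ((d : ZMod ℓ)) = ℓ - 1}.Infinite) :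
    ∀ B : ℕ, ∃ α : Fin (n + 1) → ℂ, (∀ i, α i ≠ 0) ∧
      ∃ f : Fin B → Submodule ℂ (Fin (n + 1) → ℂ),
        Function.Injective f ∧ ∀ b, f b ∈ exceptionalSubspaces α d n := by
  intro B
  obtain ⟨k, rfl⟩ : ∃ k, n = k + 1 := ⟨n - 1, by omega⟩
  have hpos : 1 < d ^ (B + 1) := Nat.one_lt_pow (by omega) (by omega)
  have hN : d ^ (B + 1) - 1 ≠ 0 := by omega
  obtain ⟨ζ, hζ⟩ : ∃ ζ : ℂ, IsPrimitiveRoot ζ (d ^ (B + 1) - 1) :=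
    ⟨_, Complex.isPrimitiveRoot_exp _ hN⟩
  have hfix : ζ ^ d ^ (B + 1) = ζ := by
    rw [← Nat.sub_add_cancel hpos.le, pow_succ, hζ.pow_eq_one, one_mul]
  have hlt : ∀ b : Fin B, d ^ (b : ℕ) < d ^ (B + 1) - 1 := by
    intro b
    have h1 : d ^ (b : ℕ) * d ≤ d ^ B := by
      rw [← pow_succ]
      exact Nat.pow_le_pow_right (by omega) b.isLt
    have h2 : d ^ (B + 1) = d ^ B * d := pow_succ d B
    have h3 : 0 < d ^ (b : ℕ) := by positivity
    have h4 : d ^ (b : ℕ) * 2 ≤ d ^ (b : ℕ) * d := Nat.mul_le_mul_left _ hd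
    have h5 : d ^ B * 2 ≤ d ^ B * d := Nat.mul_le_mul_left _ hd
    omega
  refine ⟨Fin.cons ζ fun j : Fin (k + 1) => 2 ^ (j : ℕ), ?_,
    fun b => LinearMap.range (consSmulHead (ζ ^ d ^ (b : ℕ))), ?_, fun b => ?_⟩
  · intro i
    refine Fin.cases ?_ (fun j => ?_) i
    · simpa using hζ.ne_zero hN
    · simp
  · intro b b' h
    have hpow := hζ.pow_inj (hlt b) (hlt b') (range_consSmulHead_injective h)
    exact Fin.ext (Nat.pow_right_injective hd hpow)
  · refine range_consSmulHead_mem_exceptionalSubspaces (fun i => b + (B + 1) * (i : ℕ))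
      (fun i => pow_pow_add_mul_eq hfix _ _) ?_
    intro i i' h
    have h2 : 2 ^ d ^ (b + (B + 1) * (i : ℕ)) = 2 ^ d ^ (b + (B + 1) * (i' : ℕ)) := by
      beta_reduce at h
      exact_mod_cast h
    have h3 := Nat.pow_right_injective hd (Nat.pow_right_injective le_rfl h2)
    exact Fin.ext (Nat.eq_of_mul_eq_mul_left (Nat.succ_pos B) (Nat.add_left_cancel h3))

end
end

section
/- Let K be an algebraically closed field of characteristic 0, n ≥ 1, 1 ≤ r ≤ n, d ≥ 2, and let P = [α_0 : ⋯ : α_n] ∈ ℙⁿ(K) have all coordinates nonzero and multiplicative relation set R(P) = {0}. Let m = (m_0,…,m_r) and m̃ = (m̃_0,…,m̃_r) be tuples of non-negative integers, each with pairwise distinct entries. Suppose that for some p ∈ P_{r,n} and some σ, τ ∈ S_{r+1} one has u_{σ,p}(m)·u_{τ,p}(m̃) = u_{τ,p}(m)·u_{σ,p}(m̃). Then for every index i ∈ {0,…,r} with σ(i) ≠ τ(i), one has m_{σ(i)} = m̃_{σ(i)} and m_{τ(i)} = m̃_{τ(i)}. -/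
open scoped BigOperators

noncomputable section

theorem le_max_of_pow_add_pow_eq {d a b c e : ℕ} (hd : 2 ≤ d)
    (h : d ^ a + d ^ b = d ^ c + d ^ e) : max c e ≤ max a b := by
  by_contra! hlt
  have hle : d ^ (max a b + 1) ≤ d ^ max c e := Nat.pow_le_pow_right (by omega) hlt
  have ha : d ^ a ≤ d ^ max a b := Nat.pow_le_pow_right (by omega) (le_max_left a b)
  have hb : d ^ b ≤ d ^ max a b := Nat.pow_le_pow_right (by omega) (le_max_right a b)
  have hdouble : 2 * d ^ max a b ≤ d ^ (max a b + 1) := by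
    rw [pow_succ']
    exact Nat.mul_le_mul_right _ hd
  have hc : 0 < d ^ c := by positivity
  have he : 0 < d ^ e := by positivity
  rcases max_choice c e with hce | hce <;> rw [hce] at hle <;> omega

/-- A sum of two powers of `d ≥ 2` determines the exponents up to order. -/
theorem eq_and_eq_or_of_pow_add_pow_eq {d a b c e : ℕ} (hd : 2 ≤ d)
    (h : d ^ a + d ^ b = d ^ c + d ^ e) : (a = c ∧ b = e) ∨ (a = e ∧ b = c) := by
  have hmax : max a b = max c e :=
    le_antisymm (le_max_of_pow_add_pow_eq hd h.symm) (le_max_of_pow_add_pow_eq hd h)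
  have hinj := Nat.pow_right_injective hd
  have key : a = c ∨ a = e ∨ b = c ∨ b = e := by omega
  rcases key with rfl | rfl | rfl | rfl
  · exact Or.inl ⟨rfl, hinj (by simpa using h)⟩
  · exact Or.inr ⟨rfl, hinj (by simp only; omega)⟩
  · exact Or.inr ⟨hinj (by simp only; omega), rfl⟩
  · exact Or.inl ⟨hinj (by simpa using h), rfl⟩

theorem eq_zero_of_prod_comp_zpow_eq_one {ι κ K : Type*} [Fintype ι] [Fintype κ] [Field K]
    {α : κ → K}
    (hrel : ∀ e : κ → ℤ, (∑ j, e j) = 0 → (∏ j, α j ^ e j) = 1 → e = 0)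
    {p : ι → κ} (hp : Function.Injective p) {c : ι → ℤ} (hsum : ∑ i, c i = 0)
    (hprod : ∏ i, α (p i) ^ c i = 1) : c = 0 := by
  have hout : ∀ j ∉ Set.range p, Function.extend p c (0 : κ → ℤ) j = 0 := fun j hj =>
    Function.extend_apply' c (0 : κ → ℤ) j hj
  have hext : Function.extend p c (0 : κ → ℤ) = 0 := by
    apply hrel
    · rw [← hsum]
      exact (Fintype.sum_of_injective p hp _ _ hout
        fun i => (hp.extend_apply c (0 : κ → ℤ) i).symm).symm
    · rw [← hprod]
      refine (Fintype.prod_of_injective p hp _ _ (fun j hj => ?_) fun i => ?_).symm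
      · rw [hout j hj, zpow_zero]
      · rw [hp.extend_apply]
  funext i
  rw [← hp.extend_apply c (0 : κ → ℤ) i, hext]
  rfl

/-- if `R(P) = {0}`, the tuples `m, m̃` have pairwise distinct entries, and
`u_{σ,p}(m)·u_{τ,p}(m̃) = u_{τ,p}(m)·u_{σ,p}(m̃)`, then `σ(i) ≠ τ(i)` implies
`m_{σ(i)} = m̃_{σ(i)}` and `m_{τ(i)} = m̃_{τ(i)}`. -/
theorem stmt15 {K : Type*} [Field K] [IsAlgClosed K] [CharZero K]
    (n r d : ℕ) (hn : 1 ≤ n) (hr1 : 1 ≤ r) (hrn : r ≤ n) (hd : 2 ≤ d)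
    (α : Fin (n + 1) → K) (hα : ∀ i, α i ≠ 0)
    (hrel : ∀ e : Fin (n + 1) → ℤ, (∑ i, e i) = 0 → (∏ i, α i ^ e i) = 1 → e = 0)
    (m m' : Fin (r + 1) → ℕ)
    (hm : Function.Injective m) (hm' : Function.Injective m')
    (p : Fin (r + 1) → Fin (n + 1)) (hp : StrictMono p)
    (σ τ : Equiv.Perm (Fin (r + 1)))
    (h : uval α d p σ m * uval α d p τ m' = uval α d p τ m * uval α d p σ m') :
    ∀ i : Fin (r + 1), σ i ≠ τ i → m (σ i) = m' (σ i) ∧ m (τ i) = m' (τ i) := by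
  have hc : (fun i => ((d ^ m (σ i) + d ^ m' (τ i) : ℕ) : ℤ)
      - ((d ^ m (τ i) + d ^ m' (σ i) : ℕ) : ℤ)) = 0 := by
    apply eq_zero_of_prod_comp_zpow_eq_one hrel hp.injective
    · push_cast
      simp only [Finset.sum_sub_distrib, Finset.sum_add_distrib]
      rw [Equiv.sum_comp σ fun j => (d : ℤ) ^ m j, Equiv.sum_comp τ fun j => (d : ℤ) ^ m j,
        Equiv.sum_comp σ fun j => (d : ℤ) ^ m' j, Equiv.sum_comp τ fun j => (d : ℤ) ^ m' j]
      ring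
    · simp only [zpow_sub₀ (hα _), zpow_natCast, pow_add, Finset.prod_div_distrib,
        Finset.prod_mul_distrib]
      have hne : uval α d p τ m * uval α d p σ m' ≠ 0 :=
        mul_ne_zero (Finset.prod_ne_zero_iff.2 fun i _ => pow_ne_zero _ (hα _))
          (Finset.prod_ne_zero_iff.2 fun i _ => pow_ne_zero _ (hα _))
      exact (div_eq_one_iff_eq hne).2 h
  intro i hi
  have hpow : d ^ m (σ i) + d ^ m' (τ i) = d ^ m (τ i) + d ^ m' (σ i) :=
    Int.ofNat_inj.1 (sub_eq_zero.1 (congrFun hc i))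
  rcases eq_and_eq_or_of_pow_add_pow_eq hd hpow with ⟨h₁, _⟩ | ⟨h₁, h₂⟩
  · exact absurd (hm h₁) hi
  · exact ⟨h₁, h₂.symm⟩

end
end
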